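/- arXiv:1807.07482 — 2 statements merged into one kernel-verified Lean document; each statement's English description precedes it below -/
import Mathlib

section
/- Let k/k₀ be a quadratic extension of finite fields of characteristic p and let R be an algebraically closed field of characteristic different from p (possibly of characteristic 0). Let π be an irreducible R-representation of GL_n(k) such that the space Hom_{GL_n(k₀)}(π, 1) of GL_n(k₀)-invariant R-linear forms on π is nonzero. Then Hom_{GL_n(k₀)}(π, 1) has dimension exactly 1 over R. -/
open Matrix

section InvariantForms

variable {R : Type} [CommRing R] {G : Type} [Monoid G] {V : Type} [AddCommGroup V] [Module R V]

/-- The space of `H`-invariant `R`-linear forms on a representation `ρ`. -/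
def invariantForms (ρ : Representation R G V) (H : Set G) : Submodule R (V →ₗ[R] R) where
  carrier := {φ | ∀ g ∈ H, ∀ v : V, φ (ρ g v) = φ v}
  add_mem' := by
    intro φ ψ hφ hψ g hg v
    simp only [LinearMap.add_apply, hφ g hg v, hψ g hg v]
  zero_mem' := by intro g hg v; simp
  smul_mem' := by
    intro c φ hφ g hg v
    simp only [LinearMap.smul_apply, hφ g hg v]

/-- A representation is irreducible if it is nonzero and its only invariant submodules
are `⊥` and `⊤`. -/
def IsIrreducibleRep (ρ : Representation R G V) : Prop :=
  (⊥ : Submodule R V) ≠ ⊤ ∧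
    ∀ W : Submodule R V, (∀ g : G, ∀ v ∈ W, ρ g v ∈ W) → W = ⊥ ∨ W = ⊤

/-- Two representations are isomorphic if there is an equivariant linear equivalence. -/
def RepIso {W : Type} [AddCommGroup W] [Module R W]
    (ρ : Representation R G V) (τ : Representation R G W) : Prop :=
  ∃ e : V ≃ₗ[R] W, ∀ (g : G) (v : V), e (ρ g v) = τ g (e v)

/-- `ρ` is (isomorphic to) a subquotient of `τ`:  there is a `τ`-invariant submodule `q`
together with an equivariant surjection from `q` onto the space of `ρ`. -/
def IsSubquotientOf {W : Type} [AddCommGroup W] [Module R W]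
    (ρ : Representation R G V) (τ : Representation R G W) : Prop :=
  ∃ (q : Submodule R W) (hq : ∀ g : G, ∀ w ∈ q, τ g w ∈ q) (f : ↥q →ₗ[R] V),
    Function.Surjective f ∧
      ∀ (g : G) (w : ↥q), f ⟨τ g w.1, hq g w.1 w.2⟩ = ρ g (f w)

end InvariantForms
section GLdefs

variable (k₀ k : Type) [Field k₀] [Field k] [Algebra k₀ k]

/-- `GL n k₀` as a subgroup of `GL n k`:  the image of the entrywise inclusion. -/
def glBase (n : ℕ) : Subgroup (GL (Fin n) k) :=
  (Units.map ((algebraMap k₀ k).mapMatrix.toMonoidHom :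
      Matrix (Fin n) (Fin n) k₀ →* Matrix (Fin n) (Fin n) k)).range

/-- The entrywise action of a field automorphism on `GL n k`. -/
def glAut (σ : k ≃ₐ[k₀] k) (n : ℕ) : GL (Fin n) k →* GL (Fin n) k :=
  Units.map (((σ : k →+* k).mapMatrix).toMonoidHom :
      Matrix (Fin n) (Fin n) k →* Matrix (Fin n) (Fin n) k)

end GLdefs

section Cancellation

variable {A : Type} [Ring A]

instance LinearMap.finite_of_finite_modules {L M : Type} [AddCommGroup L] [AddCommGroup M]
    [Module A L] [Module A M] [Finite L] [Finite M] : Finite (L →ₗ[A] M) :=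
  Finite.of_injective (fun f => (f : L → M)) DFunLike.coe_injective

/-- Linear maps out of `L` are classified by their kernel and the induced injective map. -/
noncomputable def LinearMap.equivSigmaInjective (A L M : Type) [Ring A] [AddCommGroup L]
    [AddCommGroup M] [Module A L] [Module A M] :
    (L →ₗ[A] M) ≃ Σ K : Submodule A L, {f : (L ⧸ K) →ₗ[A] M // Function.Injective f} where
  toFun f := ⟨LinearMap.ker f, (LinearMap.ker f).liftQ f le_rfl, by
    rw [← LinearMap.ker_eq_bot]; exact Submodule.ker_liftQ_eq_bot _ _ _ le_rfl⟩
  invFun x := x.2.1.comp x.1.mkQ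
  left_inv f := by ext; simp
  right_inv := by
    rintro ⟨K, f, hf⟩
    have hK : LinearMap.ker (f.comp K.mkQ) = K := by
      rw [LinearMap.ker_comp, LinearMap.ker_eq_bot.2 hf]
      exact K.ker_mkQ
    have key : ∀ (K' : Submodule A L) (h : K' = K) (h1 : K' ≤ LinearMap.ker (f.comp K.mkQ))
        (h2 : Function.Injective (K'.liftQ (f.comp K.mkQ) h1)),
        (⟨K', K'.liftQ (f.comp K.mkQ) h1, h2⟩ :
          Σ K : Submodule A L, {f : (L ⧸ K) →ₗ[A] M // Function.Injective f}) = ⟨K, f, hf⟩ := by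
      rintro K' rfl h1 h2
      congr 2
      ext
      simp
    exact key _ hK _ _

theorem card_injective_eq_of_card_linearMap_eq {M N : Type} [AddCommGroup M] [AddCommGroup N]
    [Module A M] [Module A N] [Finite M] [Finite N]
    (h : ∀ (L : Type) [AddCommGroup L] [Module A L] [Finite L],
      Nat.card (L →ₗ[A] M) = Nat.card (L →ₗ[A] N))
    (L : Type) [AddCommGroup L] [Module A L] [Finite L] :
    Nat.card {f : L →ₗ[A] M // Function.Injective f} =
      Nat.card {f : L →ₗ[A] N // Function.Injective f} := by
  induction hn : Nat.card L using Nat.strong_induction_on generalizing L with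
  | _ n ih =>
  have bot : ∀ (P : Type) [AddCommGroup P] [Module A P],
      Nat.card {f : (L ⧸ (⊥ : Submodule A L)) →ₗ[A] P // Function.Injective f} =
        Nat.card {f : L →ₗ[A] P // Function.Injective f} := by
    intro P _ _
    refine Nat.card_congr (Equiv.subtypeEquiv
      ((Submodule.quotEquivOfEqBot (⊥ : Submodule A L) rfl).congrLeft P ℕ).toEquiv fun f => ?_)
    exact (Function.Injective.of_comp_iff' f
      (Submodule.quotEquivOfEqBot (⊥ : Submodule A L) rfl).symm.bijective).symm
  have key := h L
  have finQ : ∀ K : Submodule A L, Finite (L ⧸ K) := fun K =>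
    Finite.of_surjective K.mkQ K.mkQ_surjective
  have : Fintype (Submodule A L) := Fintype.ofFinite _
  rw [Nat.card_congr (LinearMap.equivSigmaInjective A L M),
    Nat.card_congr (LinearMap.equivSigmaInjective A L N), Nat.card_sigma, Nat.card_sigma] at key
  classical
  rw [Fintype.sum_eq_add_sum_compl ⊥, Fintype.sum_eq_add_sum_compl ⊥, bot, bot,
    Finset.sum_congr rfl] at key
  · exact Nat.add_right_cancel key
  · intro K hK
    refine ih _ ?_ (L ⧸ K) rfl
    rw [Finset.mem_compl, Finset.mem_singleton] at hK
    obtain ⟨x, hxK, hx⟩ := Submodule.exists_mem_ne_zero_of_ne_bot hK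
    rw [← hn]
    refine lt_of_le_of_ne (Nat.card_le_card_of_surjective _ K.mkQ_surjective) fun hc => hx ?_
    have := (Nat.bijective_iff_surjective_and_card K.mkQ).2 ⟨K.mkQ_surjective, hc.symm⟩
    exact this.1 (by simpa using hxK)

/-- Finite modules are determined by the number of homomorphisms they receive. -/
theorem nonempty_linearEquiv_of_card_linearMap_eq {M N : Type} [AddCommGroup M] [AddCommGroup N]
    [Module A M] [Module A N] [Finite M] [Finite N]
    (h : ∀ (L : Type) [AddCommGroup L] [Module A L] [Finite L],
      Nat.card (L →ₗ[A] M) = Nat.card (L →ₗ[A] N)) :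
    Nonempty (M ≃ₗ[A] N) := by
  have h₁ := card_injective_eq_of_card_linearMap_eq h M
  have h₂ := card_injective_eq_of_card_linearMap_eq h N
  have : Nonempty {f : M →ₗ[A] M // Function.Injective f} := ⟨⟨.id, fun _ _ h => h⟩⟩
  have : Nonempty {f : N →ₗ[A] N // Function.Injective f} := ⟨⟨.id, fun _ _ h => h⟩⟩
  have p₁ : 0 < Nat.card {f : M →ₗ[A] M // Function.Injective f} := Nat.card_pos
  have p₂ : 0 < Nat.card {f : N →ₗ[A] N // Function.Injective f} := Nat.card_pos
  rw [h₁] at p₁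
  rw [← h₂] at p₂
  obtain ⟨f, hf⟩ := (Nat.card_pos_iff.1 p₁).1
  obtain ⟨g, hg⟩ := (Nat.card_pos_iff.1 p₂).1
  have hc : Nat.card M = Nat.card N :=
    le_antisymm (Nat.card_le_card_of_injective f hf) (Nat.card_le_card_of_injective g hg)
  exact ⟨LinearEquiv.ofBijective f ((Nat.bijective_iff_injective_and_card f).2 ⟨hf, hc⟩)⟩

/-- Finite powers of finite modules can be cancelled. -/
theorem nonempty_linearEquiv_of_pi {ι : Type} [Fintype ι] [Nonempty ι] {M N : Type}
    [AddCommGroup M] [AddCommGroup N] [Module A M] [Module A N] [Finite M] [Finite N]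
    (e : (ι → M) ≃ₗ[A] (ι → N)) : Nonempty (M ≃ₗ[A] N) := by
  refine nonempty_linearEquiv_of_card_linearMap_eq fun L _ _ _ => ?_
  have pow : ∀ (P : Type) [AddCommGroup P] [Module A P] [Finite P],
      Nat.card (L →ₗ[A] (ι → P)) = Nat.card (L →ₗ[A] P) ^ Fintype.card ι := by
    intro P _ _ _
    let e : (L →ₗ[A] (ι → P)) ≃ (ι → (L →ₗ[A] P)) :=
      { toFun := fun f i => (LinearMap.proj i).comp f
        invFun := fun f => LinearMap.pi f
        left_inv := fun _ => rfl
        right_inv := fun _ => rfl }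
    rw [Nat.card_congr e, Nat.card_fun, Nat.card_eq_fintype_card (α := ι)]
  refine Nat.pow_left_injective (n := Fintype.card ι) Fintype.card_ne_zero ?_
  simp only [← pow]
  exact Nat.card_congr
    { toFun := fun f => e.toLinearMap.comp f
      invFun := fun f => e.symm.toLinearMap.comp f
      left_inv := fun _ => by ext; simp
      right_inv := fun _ => by ext; simp }

end Cancellation

/-- A linear automorphism of `Kⁿ` as an invertible matrix. -/
theorem exists_unit_of_linearEquiv {K : Type} [Field K] {n : ℕ}
    (E : (Fin n → K) ≃ₗ[K] (Fin n → K)) :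
    ∃ P : (Matrix (Fin n) (Fin n) K)ˣ, ∀ B C : Matrix (Fin n) (Fin n) K,
      (P : Matrix (Fin n) (Fin n) K) * B = C * P ↔ ∀ v, E (B *ᵥ v) = C *ᵥ E v := by
  refine ⟨⟨LinearMap.toMatrix' E.toLinearMap, LinearMap.toMatrix' E.symm.toLinearMap, ?_, ?_⟩,
    fun B C => ?_⟩
  · rw [← LinearMap.toMatrix'_comp, LinearEquiv.comp_symm, LinearMap.toMatrix'_id]
  · rw [← LinearMap.toMatrix'_comp, LinearEquiv.symm_comp, LinearMap.toMatrix'_id]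
  · rw [← Matrix.toLin'.injective.eq_iff, Matrix.toLin'_mul, Matrix.toLin'_mul,
      Matrix.toLin'_toMatrix', LinearMap.ext_iff]
    rfl

section Transpose

open Polynomial Module

/-- Homomorphisms out of a cyclic module are torsion elements. -/
noncomputable def quotSpanHomEquiv {A M : Type} [CommRing A] [AddCommGroup M] [Module A M] (p : A) :
    ((A ⧸ A ∙ p) →ₗ[A] M) ≃ {m : M // p • m = 0} where
  toFun f := ⟨f ((A ∙ p).mkQ 1), by
    rw [← map_smul, ← map_smul, smul_eq_mul, mul_one, Submodule.mkQ_apply,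
      (Submodule.Quotient.mk_eq_zero _).2 (Submodule.mem_span_singleton_self p), map_zero]⟩
  invFun m := Submodule.liftQSpanSingleton p (LinearMap.toSpanSingleton A M m.1)
    (by simpa using m.2)
  left_inv f := by
    refine LinearMap.ext fun x => ?_
    obtain ⟨x, rfl⟩ := (A ∙ p).mkQ_surjective x
    refine (Submodule.liftQ_apply _ _ _).trans ?_
    rw [LinearMap.toSpanSingleton_apply, ← map_smul, ← map_smul, smul_eq_mul, mul_one]
  right_inv m := by
    ext
    exact (Submodule.liftQ_apply _ _ _).trans (by simp)

theorem card_torsion_aeval {K : Type} [Field K] [Finite K] {n : ℕ} (B : Matrix (Fin n) (Fin n) K)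
    (p : K[X]) : Nat.card {m : AEval' B.toLin' // p • m = 0} =
      Nat.card K ^ (n - (aeval B p).rank) := by
  have h1 : aeval B.toLin' p = (aeval B p).toLin' :=
    aeval_algHom_apply (Matrix.toLinAlgEquiv' (R := K) (n := Fin n)).toAlgHom B p
  have e : {m : AEval' B.toLin' // p • m = 0} ≃ LinearMap.ker (aeval B p).toLin' :=
    (AEval'.of B.toLin').symm.toEquiv.subtypeEquiv fun m => by
      rw [LinearMap.mem_ker, ← h1]
      change _ ↔ aeval B.toLin' p • (AEval.of _ _ _).symm m = 0
      rw [← AEval.of_symm_smul, LinearEquiv.map_eq_zero_iff]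
  have h2 := (aeval B p).toLin'.finrank_range_add_finrank_ker
  rw [Nat.card_congr e, Module.natCard_eq_pow_finrank (K := K)]
  congr 1
  rw [Module.finrank_fin_fun] at h2
  rw [Matrix.rank_eq_finrank_range_toLin _ (Pi.basisFun K _) (Pi.basisFun K _)]
  rw [Matrix.toLin_eq_toLin']
  omega

theorem module_isTorsion_of_finite {A L : Type} [CommRing A] [IsDomain A] [Infinite A]
    [AddCommGroup L] [Module A L] [Finite L] : Module.IsTorsion A L := by
  intro x
  obtain ⟨a, b, hab, h⟩ := Finite.exists_ne_map_eq_of_infinite fun a : A => a • x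
  exact ⟨⟨a - b, mem_nonZeroDivisors_of_ne_zero (sub_ne_zero.2 hab)⟩, by
    simpa [Submonoid.smul_def, sub_smul, sub_eq_zero] using h⟩

/-- A square matrix over a finite field is similar to its transpose. -/
theorem exists_conj_transpose {K : Type} [Field K] [Finite K] {n : ℕ}
    (B : Matrix (Fin n) (Fin n) K) :
    ∃ P : (Matrix (Fin n) (Fin n) K)ˣ, (P : Matrix (Fin n) (Fin n) K) * B = Bᵀ * P := by
  have : Finite (AEval' B.toLin') := Finite.of_equiv _ (AEval'.of B.toLin').toEquiv
  have : Finite (AEval' Bᵀ.toLin') := Finite.of_equiv _ (AEval'.of Bᵀ.toLin').toEquiv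
  obtain ⟨e⟩ : Nonempty (AEval' B.toLin' ≃ₗ[K[X]] AEval' Bᵀ.toLin') := by
    refine nonempty_linearEquiv_of_card_linearMap_eq fun L _ _ _ => ?_
    obtain ⟨ι, _, p, -, d, ⟨f⟩⟩ :=
      Module.equiv_directSum_of_isTorsion (module_isTorsion_of_finite (A := K[X]) (L := L))
    classical
    have key : ∀ (M : Type) [AddCommGroup M] [Module K[X] M], Nat.card (L →ₗ[K[X]] M) =
        ∏ i, Nat.card {m : M // p i ^ d i • m = 0} := by
      intro M _ _
      rw [Nat.card_congr ((f.congrLeft M ℕ).toEquiv.trans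
        (DFinsupp.lsum (M := fun i => K[X] ⧸ K[X] ∙ p i ^ d i) ℕ).symm.toEquiv), Nat.card_pi]
      exact Finset.prod_congr rfl fun i _ => Nat.card_congr (quotSpanHomEquiv _)
    rw [key, key]
    refine Finset.prod_congr rfl fun i _ => ?_
    rw [card_torsion_aeval, card_torsion_aeval]
    have : aeval Bᵀ (p i ^ d i) = (aeval B (p i ^ d i))ᵀ := by
      induction p i ^ d i using Polynomial.induction_on' with
      | add q r hq hr => simp [hq, hr]
      | monomial m c => simp [aeval_monomial, ← Algebra.smul_def, Matrix.transpose_pow]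
    rw [this, Matrix.rank_transpose]
  obtain ⟨P, hP⟩ := exists_unit_of_linearEquiv
    ((AEval'.of B.toLin').trans ((e.restrictScalars K).trans (AEval'.of Bᵀ.toLin').symm))
  refine ⟨P, (hP B Bᵀ).2 fun v => ?_⟩
  change (AEval'.of Bᵀ.toLin').symm (e (AEval'.of B.toLin' (B.toLin' v))) =
    Bᵀ.toLin' ((AEval'.of Bᵀ.toLin').symm (e (AEval'.of B.toLin' v)))
  rw [← AEval'.X_smul_of, map_smul, ← AEval'.of_symm_X_smul]

end Transpose

section Descent

theorem exists_linearEquiv_of_pi {K V W ι J : Type} [Field K] [AddCommGroup V] [AddCommGroup W]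
    [Module K V] [Module K W] [Finite V] [Finite W] [Fintype J] [Nonempty J]
    (a : ι → Module.End K V) (b : ι → Module.End K W) (Φ : (J → V) ≃ₗ[K] (J → W))
    (hΦ : ∀ i u, Φ (fun j => a i (u j)) = fun j => b i (Φ u j)) :
    ∃ E : V ≃ₗ[K] W, ∀ i v, E (a i v) = b i (E v) := by
  let _ : Module (FreeAlgebra K ι) V := Module.compHom V (FreeAlgebra.lift K a).toRingHom
  let _ : Module (FreeAlgebra K ι) W := Module.compHom W (FreeAlgebra.lift K b).toRingHom
  have hV : ∀ i (v : V), FreeAlgebra.ι K i • v = a i v := fun i v =>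
    congr($(FreeAlgebra.lift_ι_apply a i) v)
  have hW : ∀ i (v : W), FreeAlgebra.ι K i • v = b i v := fun i v =>
    congr($(FreeAlgebra.lift_ι_apply b i) v)
  have hV' : ∀ c (v : V), algebraMap K (FreeAlgebra K ι) c • v = c • v := fun c v =>
    congr($((FreeAlgebra.lift K a).commutes c) v)
  have hW' : ∀ c (v : W), algebraMap K (FreeAlgebra K ι) c • v = c • v := fun c v =>
    congr($((FreeAlgebra.lift K b).commutes c) v)
  have hsmul : ∀ (x : FreeAlgebra K ι) (u : J → V), Φ (x • u) = x • Φ u := by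
    intro x
    induction x using FreeAlgebra.induction with
    | grade0 c =>
      intro u
      rw [show algebraMap K (FreeAlgebra K ι) c • u = c • u from funext fun _ => hV' c _, map_smul]
      exact (funext fun _ => hW' c _).symm
    | grade1 i =>
      intro u
      rw [show FreeAlgebra.ι K i • u = fun j => a i (u j) from funext fun _ => hV i _, hΦ]
      exact (funext fun _ => hW i _).symm
    | mul x y hx hy => intro u; rw [mul_smul, hx, hy, mul_smul]
    | add x y hx hy => intro u; rw [add_smul, map_add, hx, hy, add_smul]
  obtain ⟨E⟩ := nonempty_linearEquiv_of_pi (A := FreeAlgebra K ι)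
    ({ Φ with map_smul' := hsmul } : (J → V) ≃ₗ[FreeAlgebra K ι] (J → W))
  refine ⟨{ E with map_smul' := fun c v => ?_ }, fun i v => ?_⟩
  · have := E.map_smul (algebraMap K (FreeAlgebra K ι) c) v
    rwa [hV', hW'] at this
  · have := E.map_smul (FreeAlgebra.ι K i) v
    rwa [hV, hW] at this

/-- Families of matrices over a finite field which are similar over a finite extension
are similar (**Noether–Deuring**). -/
theorem exists_conj_of_conj_map {K L ι : Type} [Field K] [Field L] [Algebra K L] [Finite K]
    [FiniteDimensional K L] {n : ℕ} (a b : ι → Matrix (Fin n) (Fin n) K)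
    (g : (Matrix (Fin n) (Fin n) L)ˣ)
    (hg : ∀ i, (g : Matrix (Fin n) (Fin n) L) * (a i).map (algebraMap K L) =
      (b i).map (algebraMap K L) * g) :
    ∃ m : (Matrix (Fin n) (Fin n) K)ˣ, ∀ i, (m : Matrix (Fin n) (Fin n) K) * a i = b i * m := by
  let B := Module.finBasis K L
  have : Nonempty (Fin (Module.finrank K L)) := ⟨⟨0, Module.finrank_pos⟩⟩
  let e : (Fin n → L) ≃ₗ[K] (Fin (Module.finrank K L) → Fin n → K) :=
    { toFun := fun u j r => B.equivFun (u r) j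
      invFun := fun w r => B.equivFun.symm fun j => w j r
      map_add' := fun u v => by ext; simp
      map_smul' := fun c v => by ext; simp
      left_inv := fun u => by ext; simp
      right_inv := fun u => by
        ext j r
        exact congr($(B.equivFun.apply_symm_apply fun j => u j r) j) }
  have he : ∀ (c : Matrix (Fin n) (Fin n) K) u,
      e (c.map (algebraMap K L) *ᵥ u) = fun j => c *ᵥ e u j := by
    intro c u
    ext j r
    change B.equivFun (∑ s, algebraMap K L (c r s) * u s) j = ∑ s, c r s * B.equivFun (u s) j
    simp [← Algebra.smul_def]
  have he' : ∀ (c : Matrix (Fin n) (Fin n) K) w,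
      e.symm (fun j => c *ᵥ w j) = c.map (algebraMap K L) *ᵥ e.symm w := by
    intro c w
    rw [LinearEquiv.symm_apply_eq, he, LinearEquiv.apply_symm_apply]
  let γ : (Fin n → L) ≃ₗ[K] (Fin n → L) :=
    { toFun := fun u => (g : Matrix (Fin n) (Fin n) L) *ᵥ u
      invFun := fun u => (g⁻¹).val *ᵥ u
      map_add' := fun u v => Matrix.mulVec_add _ _ _
      map_smul' := fun c v => Matrix.mulVec_smul _ _ _
      left_inv := fun u => by simp [Matrix.mulVec_mulVec]
      right_inv := fun u => by simp [Matrix.mulVec_mulVec] }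
  obtain ⟨E, hE⟩ := exists_linearEquiv_of_pi (fun i => (a i).toLin') (fun i => (b i).toLin')
    (e.symm.trans (γ.trans e)) fun i u => by
      simp only [LinearEquiv.trans_apply, Matrix.toLin'_apply]
      rw [he', ← he]
      congr 1
      change (g : Matrix (Fin n) (Fin n) L) *ᵥ _ = _ *ᵥ ((g : Matrix (Fin n) (Fin n) L) *ᵥ _)
      rw [Matrix.mulVec_mulVec, Matrix.mulVec_mulVec, hg]
  obtain ⟨P, hP⟩ := exists_unit_of_linearEquiv E
  exact ⟨P, fun i => (hP _ _).2 (hE i)⟩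

end Descent

/-- **Burnside's theorem**. -/
theorem exists_smul_eq_of_isSimpleModule {R A V : Type} [Field R] [IsAlgClosed R] [Ring A]
    [Algebra R A] [AddCommGroup V] [Module R V] [Module A V] [IsScalarTower R A V]
    [FiniteDimensional R V] [IsSimpleModule A V] (f : Module.End R V) :
    ∃ a : A, ∀ v, a • v = f v := by
  have hb := IsSimpleModule.algebraMap_end_bijective_of_isAlgClosed (A := A) (V := V) R
  let F : Module.End (Module.End A V) V :=
    { f with
      map_smul' := fun x v => by
        obtain ⟨c, rfl⟩ := hb.2 x
        simp }
  obtain ⟨s, hs⟩ := Module.Finite.fg_top (R := R) (M := V)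
  obtain ⟨r, hr⟩ := jacobson_density F s
  refine ⟨r, fun v => ?_⟩
  have : Algebra.lsmul R R V r = f := by
    refine LinearMap.ext_on hs fun m hm => ?_
    exact (hr m hm).symm
  exact congr($this v)

theorem finiteDimensional_of_irreducible {R : Type} [Field R] {G : Type} [Group G] [Finite G]
    {V : Type} [AddCommGroup V] [Module R V] (ρ : Representation R G V)
    (h : ∀ W : Submodule R V, (∀ g : G, ∀ v ∈ W, ρ g v ∈ W) → W = ⊥ ∨ W = ⊤) :
    FiniteDimensional R V := by
  rcases subsingleton_or_nontrivial V with hV | hV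
  · infer_instance
  obtain ⟨v, hv⟩ := exists_ne (0 : V)
  have h1 := (h (Submodule.span R (Set.range fun g => ρ g v)) fun g w hw => by
    induction hw using Submodule.span_induction with
    | mem x hx =>
      obtain ⟨g', rfl⟩ := hx
      exact Submodule.subset_span ⟨g * g', by simp⟩
    | zero => simp
    | add x y _ _ hx hy => rw [map_add]; exact add_mem hx hy
    | smul c x _ hx => rw [map_smul]; exact Submodule.smul_mem _ _ hx).resolve_left fun h0 => hv (by
      have : v ∈ Submodule.span R (Set.range fun g => ρ g v) :=
        Submodule.subset_span ⟨1, by simp⟩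
      rwa [h0, Submodule.mem_bot] at this)
  exact ⟨h1 ▸ Submodule.fg_span (Set.finite_range _)⟩

theorem asAlgebraHom_surjective {R : Type} [Field R] [IsAlgClosed R] {G : Type} [Group G] [Finite G]
    {V : Type} [AddCommGroup V] [Module R V] (ρ : Representation R G V)
    (hnt : (⊥ : Submodule R V) ≠ ⊤)
    (h : ∀ W : Submodule R V, (∀ g : G, ∀ v ∈ W, ρ g v ∈ W) → W = ⊥ ∨ W = ⊤) :
    Function.Surjective ρ.asAlgebraHom := by
  have := finiteDimensional_of_irreducible ρ h
  let _ : Module (MonoidAlgebra R G) V := Module.compHom V ρ.asAlgebraHom.toRingHom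
  have smul_eq : ∀ (a : MonoidAlgebra R G) (v : V), a • v = ρ.asAlgebraHom a v := fun _ _ => rfl
  have : IsScalarTower R (MonoidAlgebra R G) V := ⟨fun c a v => by simp [smul_eq]⟩
  have : Nontrivial V := (Submodule.nontrivial_iff R).1 ⟨⊥, ⊤, hnt⟩
  have : IsSimpleModule (MonoidAlgebra R G) V := by
    rw [isSimpleModule_iff]
    refine { eq_bot_or_eq_top := fun W => ?_ }
    refine (h (W.restrictScalars R) fun g v hv => ?_).imp (fun e => ?_) (fun e => ?_)
    · have := W.smul_mem (MonoidAlgebra.single g 1) hv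
      rwa [smul_eq, ρ.asAlgebraHom_single_one] at this
    · exact (Submodule.restrictScalars_eq_bot_iff _ _ _).1 e
    · exact (Submodule.restrictScalars_eq_top_iff _ _ _).1 e
  intro f
  obtain ⟨a, ha⟩ := exists_smul_eq_of_isSimpleModule (A := MonoidAlgebra R G) f
  exact ⟨a, LinearMap.ext ha⟩

section Gelfand

variable {R : Type} [Field R] {G : Type} [Group G] {V : Type} [AddCommGroup V] [Module R V]

/-- The antihomomorphism `∑ c_g g ↦ ∑ c_g ρ (θ g)⁻¹` from the group algebra to `End V`. -/
noncomputable def antiHom (ρ : Representation R G V) (θ : G ≃* G) :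
    MonoidAlgebra R G →ₐ[R] (Module.End R V)ᵐᵒᵖ :=
  MonoidAlgebra.lift R (Module.End R V)ᵐᵒᵖ G
    { toFun := fun g => MulOpposite.op (ρ (θ g)⁻¹)
      map_one' := by simp
      map_mul' := fun g h => by simp [← MulOpposite.op_mul] }

@[simp] theorem unop_antiHom_single (ρ : Representation R G V) (θ : G ≃* G) (g : G) (c : R) :
    (antiHom ρ θ (MonoidAlgebra.single g c)).unop = c • ρ (θ g)⁻¹ := by
  simp [antiHom]

theorem antiHom_surjective (ρ : Representation R G V) (θ : G ≃* G)
    (hs : Function.Surjective ρ.asAlgebraHom) (f : Module.End R V) :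
    ∃ a, (antiHom ρ θ a).unop = f := by
  obtain ⟨a, rfl⟩ := hs f
  induction a using MonoidAlgebra.induction_linear with
  | zero => exact ⟨0, by simp⟩
  | add a b ha hb =>
    obtain ⟨x, hx⟩ := ha
    obtain ⟨y, hy⟩ := hb
    exact ⟨x + y, by simp [hx, hy]⟩
  | single g c => exact ⟨MonoidAlgebra.single (θ.symm g⁻¹) c, by simp⟩

theorem eq_zero_of_trace_mul_eq_zero [FiniteDimensional R V] (X : Module.End R V)
    (h : ∀ Y, LinearMap.trace R V (X * Y) = 0) : X = 0 := by
  ext w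
  rw [LinearMap.zero_apply, ← Module.forall_dual_apply_eq_zero_iff R]
  intro l
  have h1 := h (l.smulRight w)
  have h2 : X * l.smulRight w = l.smulRight (X w) := by ext; simp
  rwa [h2, LinearMap.trace_smulRight] at h1

/-- If every `(θ g)⁻¹` is conjugate to `g` and `θ` preserves `H`, then an `H`-distinguished
irreducible representation has a nonzero `H`-fixed vector. -/
theorem exists_fixed_of_invariantForms_ne_zero [FiniteDimensional R V] (ρ : Representation R G V)
    (hs : Function.Surjective ρ.asAlgebraHom) (H : Set G) (θ : G ≃* G)
    (hθ : ∀ g, IsConj g (θ g)⁻¹) (hθH : ∀ h ∈ H, ∃ h' ∈ H, (θ h')⁻¹ = h)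
    {l : V →ₗ[R] R} (hl : l ∈ invariantForms ρ H) (hl0 : l ≠ 0) :
    ∃ v : V, v ≠ 0 ∧ ∀ h ∈ H, ρ h v = v := by
  have htr : ∀ a, LinearMap.trace R V (antiHom ρ θ a).unop =
      LinearMap.trace R V (ρ.asAlgebraHom a) := by
    intro a
    induction a using MonoidAlgebra.induction_linear with
    | zero => simp
    | add a b ha hb => simp [ha, hb]
    | single g c =>
      obtain ⟨u, hu⟩ := isConj_iff.1 (hθ g)
      simp only [unop_antiHom_single, ρ.asAlgebraHom_single, map_smul, ← hu]
      rw [map_mul, LinearMap.trace_mul_comm, ← map_mul]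
      simp
  have hker : ∀ a, ρ.asAlgebraHom a = 0 ↔ (antiHom ρ θ a).unop = 0 := by
    intro a
    constructor
    · intro ha
      refine eq_zero_of_trace_mul_eq_zero _ fun Y => ?_
      obtain ⟨b, rfl⟩ := antiHom_surjective ρ θ hs Y
      rw [← MulOpposite.unop_mul, ← map_mul, htr, map_mul, ha, mul_zero, map_zero]
    · intro ha
      refine eq_zero_of_trace_mul_eq_zero _ fun Y => ?_
      obtain ⟨b, rfl⟩ := hs Y
      rw [← map_mul, ← htr, map_mul, MulOpposite.unop_mul, ha, mul_zero, map_zero]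
  obtain ⟨w, hw⟩ : ∃ w, l w ≠ 0 := by
    by_contra! hc
    exact hl0 (LinearMap.ext hc)
  obtain ⟨a, ha⟩ := hs (l.smulRight w)
  have hne : (antiHom ρ θ a).unop ≠ 0 := by
    intro h0
    have := congr($ha w)
    rw [(hker a).2 h0] at this
    rcases smul_eq_zero.1 this.symm with h | h
    · exact hw h
    · exact hw (by rw [h, map_zero])
  obtain ⟨x, hx⟩ : ∃ x, (antiHom ρ θ a).unop x ≠ 0 := by
    by_contra! hc
    exact hne (LinearMap.ext hc)
  refine ⟨_, hx, fun h hh => ?_⟩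
  obtain ⟨h', hh', rfl⟩ := hθH h hh
  have h1 : ρ.asAlgebraHom (a * MonoidAlgebra.single h' 1 - a) = 0 := by
    rw [map_sub, map_mul, ha, ρ.asAlgebraHom_single_one, sub_eq_zero]
    ext v
    simp [show l (ρ h' v) = l v from hl h' hh' v]
  rw [hker, map_sub, map_mul, MulOpposite.unop_sub, MulOpposite.unop_mul, sub_eq_zero,
    unop_antiHom_single, one_smul] at h1
  exact congr($h1 x)

theorem exists_end_apply_eq {v : V} (hv : v ≠ 0) (u : V) : ∃ Y : Module.End R V, Y v = u := by
  obtain ⟨l, hl⟩ : ∃ l : Module.Dual R V, l v ≠ 0 := by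
    by_contra! hc
    exact hv ((Module.forall_dual_apply_eq_zero_iff R v).1 hc)
  exact ⟨l.smulRight ((l v)⁻¹ • u), by simp [hl]⟩

/-- If every `(σ g)⁻¹` lies in the double coset `H g H`, the `H`-invariant forms on an irreducible
representation with a nonzero `H`-fixed vector are pairwise proportional. -/
theorem exists_smul_eq_of_fixed (ρ : Representation R G V)
    (hs : Function.Surjective ρ.asAlgebraHom) (H : Set G) (σ : G ≃* G)
    (hσ : ∀ g, ∃ h ∈ H, ∃ h' ∈ H, (σ g)⁻¹ = h * g * h')
    {v : V} (hv0 : v ≠ 0) (hv : ∀ h ∈ H, ρ h v = v)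
    {l₁ l₂ : V →ₗ[R] R} (hl₁ : l₁ ∈ invariantForms ρ H) (hl₁0 : l₁ ≠ 0)
    (hl₂ : l₂ ∈ invariantForms ρ H) : ∃ c : R, c • l₁ = l₂ := by
  have hsymm : ∀ l ∈ invariantForms ρ H, ∀ a,
      l (ρ.asAlgebraHom a v) = l ((antiHom ρ σ a).unop v) := by
    intro l hl a
    induction a using MonoidAlgebra.induction_linear with
    | zero => simp
    | add a b ha hb => simp [ha, hb]
    | single g c =>
      obtain ⟨h, hh, h', hh', e⟩ := hσ g
      rw [unop_antiHom_single, e, ρ.asAlgebraHom_single]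
      simp [hv h' hh', show ∀ v, l (ρ h v) = l v from hl h hh]
  by_contra hc
  obtain ⟨u, hu₁, hu₂⟩ : ∃ u, l₁ u = 0 ∧ l₂ u ≠ 0 := by
    by_contra! hk
    obtain ⟨w, hw⟩ : ∃ w, l₁ w ≠ 0 := by
      by_contra! hw
      exact hl₁0 (LinearMap.ext hw)
    refine hc ⟨l₂ w / l₁ w, LinearMap.ext fun x => ?_⟩
    have := hk (l₁ w • x - l₁ x • w) (by simp [mul_comm])
    simp only [map_sub, map_smul, smul_eq_mul] at this
    simp only [LinearMap.smul_apply, smul_eq_mul]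
    field_simp
    linear_combination -this
  obtain ⟨a, ha⟩ := hs (l₂.smulRight u)
  have h0 : (antiHom ρ σ a).unop v = 0 := by
    by_contra hne
    obtain ⟨w, hw⟩ : ∃ w, l₁ w ≠ 0 := by
      by_contra! hw
      exact hl₁0 (LinearMap.ext hw)
    obtain ⟨Y, hY⟩ := exists_end_apply_eq (R := R) hne w
    obtain ⟨b, rfl⟩ := antiHom_surjective ρ σ hs Y
    have := hsymm l₁ hl₁ (a * b)
    rw [map_mul, map_mul, ha, MulOpposite.unop_mul, Module.End.mul_apply, Module.End.mul_apply, hY,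
      LinearMap.smulRight_apply, map_smul, hu₁, smul_zero] at this
    exact hw this.symm
  obtain ⟨Y, hY⟩ := exists_end_apply_eq (R := R) hv0 u
  obtain ⟨b, rfl⟩ := hs Y
  have := hsymm l₂ hl₂ (a * b)
  rw [map_mul, map_mul, ha, MulOpposite.unop_mul, Module.End.mul_apply, Module.End.mul_apply, hY,
    h0, LinearMap.smulRight_apply, map_smul, map_zero, map_zero] at this
  simp [hu₂] at this

end Gelfand

section GeneralLinear

variable {k₀ k : Type} [Field k₀] [Field k] [Algebra k₀ k]

/-- The nontrivial automorphism of a quadratic Galois extension. -/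
theorem exists_conjugation [IsGalois k₀ k] (hquad : Module.finrank k₀ k = 2) :
    ∃ σ : k ≃ₐ[k₀] k, (∀ x, σ (σ x) = x) ∧ (∀ x, σ x = x → ∃ c, algebraMap k₀ k c = x) ∧
      ∃ δ, σ δ ≠ δ := by
  have : FiniteDimensional k₀ k := .of_finrank_pos (by omega)
  have hcard : Nat.card (k ≃ₐ[k₀] k) = 2 := by rw [IsGalois.card_aut_eq_finrank, hquad]
  obtain ⟨σ, hσ, huniq⟩ := (Nat.card_eq_two_iff' (1 : k ≃ₐ[k₀] k)).1 hcard
  refine ⟨σ, fun x => ?_, fun x hx => ?_, ?_⟩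
  · have : σ ^ 2 = 1 := hcard ▸ pow_card_eq_one'
    exact congr($((sq σ).symm.trans this) x)
  · refine Algebra.mem_bot.1 ((IsGalois.mem_bot_iff_fixed x).2 fun f => ?_)
    by_cases hf : f = 1
    · simp [hf]
    · rw [huniq f hf, hx]
  · by_contra! h
    exact hσ (AlgEquiv.ext h)

/-- The automorphism `g ↦ (gᵀ)⁻¹` of `GL n`. -/
def glInvTranspose (n : ℕ) : GL (Fin n) k ≃* GL (Fin n) k :=
  (Units.mapEquiv (Matrix.transposeRingEquiv (Fin n) k).toMulEquiv).trans
    (Units.opEquiv.trans (MulEquiv.inv' _).symm)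

theorem coe_inv_glInvTranspose (n : ℕ) (g : GL (Fin n) k) :
    ((glInvTranspose n g)⁻¹ : GL (Fin n) k).val = g.valᵀ := by
  change (((_ : GL (Fin n) k)⁻¹)⁻¹ : GL (Fin n) k).val = _
  rw [inv_inv]
  rfl

theorem isConj_inv_glInvTranspose [Finite k] (n : ℕ) (g : GL (Fin n) k) :
    IsConj g (glInvTranspose n g)⁻¹ := by
  obtain ⟨P, hP⟩ := exists_conj_transpose g.val
  refine isConj_iff.2 ⟨P, mul_inv_eq_of_eq_mul (Units.ext ?_)⟩
  rw [Units.val_mul, Units.val_mul, coe_inv_glInvTranspose, hP]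

theorem exists_inv_glInvTranspose_eq (n : ℕ) {h : GL (Fin n) k} (hh : h ∈ glBase k₀ k n) :
    ∃ h' ∈ glBase k₀ k n, (glInvTranspose n h')⁻¹ = h := by
  obtain ⟨m, rfl⟩ := hh
  refine ⟨_, ⟨(glInvTranspose n m)⁻¹, rfl⟩, Units.ext ?_⟩
  rw [coe_inv_glInvTranspose]
  change (((glInvTranspose n m)⁻¹).val.map (algebraMap k₀ k))ᵀ = m.val.map (algebraMap k₀ k)
  rw [coe_inv_glInvTranspose]
  rfl

theorem exists_map_eq_of_fixed {σ : k ≃ₐ[k₀] k}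
    (hfix : ∀ x, σ x = x → ∃ c, algebraMap k₀ k c = x) {n : ℕ} {a : Matrix (Fin n) (Fin n) k}
    (ha : a.map σ = a) : ∃ b : Matrix (Fin n) (Fin n) k₀, b.map (algebraMap k₀ k) = a := by
  choose b hb using fun i j => hfix (a i j) congr($ha i j)
  exact ⟨Matrix.of b, Matrix.ext hb⟩

theorem coe_glAut (σ : k ≃ₐ[k₀] k) (n : ℕ) (g : GL (Fin n) k) :
    (glAut k₀ k σ n g).val = g.val.map σ := rfl

theorem mem_glBase_of_fixed {σ : k ≃ₐ[k₀] k}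
    (hfix : ∀ x, σ x = x → ∃ c, algebraMap k₀ k c = x) {n : ℕ} {g : GL (Fin n) k}
    (hg : glAut k₀ k σ n g = g) : g ∈ glBase k₀ k n := by
  have hg' : glAut k₀ k σ n g⁻¹ = g⁻¹ := by rw [map_inv, hg]
  obtain ⟨a, ha⟩ := exists_map_eq_of_fixed hfix (congrArg Units.val hg)
  obtain ⟨b, hb⟩ := exists_map_eq_of_fixed hfix (congrArg Units.val hg')
  have hinj : Function.Injective ((algebraMap k₀ k).mapMatrix (m := Fin n)) :=
    Matrix.map_injective (algebraMap k₀ k).injective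
  refine ⟨⟨a, b, hinj ?_, hinj ?_⟩, Units.ext ha⟩
  · rw [map_mul, map_one, RingHom.mapMatrix_apply, RingHom.mapMatrix_apply, ha, hb, Units.mul_inv]
  · rw [map_mul, map_one, RingHom.mapMatrix_apply, RingHom.mapMatrix_apply, ha, hb, Units.inv_mul]

/-- `(σ g)⁻¹` lies in the double coset of `g` modulo `GL n k₀`. -/
theorem exists_inv_glAut_eq [Finite k₀] [FiniteDimensional k₀ k] {σ : k ≃ₐ[k₀] k}
    (hinv : ∀ x, σ (σ x) = x) (hfix : ∀ x, σ x = x → ∃ c, algebraMap k₀ k c = x) {δ : k}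
    (hδ : σ δ ≠ δ) {n : ℕ} (g : GL (Fin n) k) :
    ∃ h ∈ glBase k₀ k n, ∃ h' ∈ glBase k₀ k n, (glAut k₀ k σ n g)⁻¹ = h * g * h' := by
  let S := glAut k₀ k σ n
  have hS : ∀ u, S (S u) = u := fun u => Units.ext (Matrix.ext fun i j => hinv (u.val i j))
  let x := g * (S g)⁻¹
  let y := (S g)⁻¹ * g
  have hx : S x = x⁻¹ := by simp [x, hS]
  have hy : S y = y⁻¹ := by simp [y, hS]
  have descend : ∀ (u : GL (Fin n) k) (c : k), S u = u⁻¹ →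
      ∃ b : Matrix (Fin n) (Fin n) k₀,
        b.map (algebraMap k₀ k) = c • u.val + σ c • (u⁻¹).val := by
    intro u c hu
    refine exists_map_eq_of_fixed hfix ?_
    rw [← hu, coe_glAut]
    ext i j
    simp [hinv, add_comm]
  choose a ha using fun c => descend x c hx
  choose b hb using fun c => descend y c hy
  have e₁ : g⁻¹ * x = y * g⁻¹ := by simp [x, y, mul_assoc]
  have e₂ : g⁻¹ * x⁻¹ = y⁻¹ * g⁻¹ := by simp [x, y, mul_assoc]
  obtain ⟨m, hm⟩ := exists_conj_of_conj_map (L := k) a b g⁻¹ fun c => by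
    rw [ha, hb, mul_add, add_mul, mul_smul_comm, mul_smul_comm, smul_mul_assoc, smul_mul_assoc]
    rw [← Units.val_mul, ← Units.val_mul, ← Units.val_mul, ← Units.val_mul, e₁, e₂]
  let M : GL (Fin n) k := Units.map (algebraMap k₀ k).mapMatrix.toMonoidHom m
  have hM : S M = M := Units.ext (Matrix.ext fun i j => σ.commutes _)
  have hMab : ∀ c, M.val * (c • x.val + σ c • (x⁻¹).val) =
      (c • y.val + σ c • (y⁻¹).val) * M.val := by
    intro c
    rw [← ha, ← hb]
    have := congrArg (algebraMap k₀ k).mapMatrix (hm c)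
    rwa [map_mul, map_mul] at this
  have hMx : M * x = y * M := by
    refine Units.ext (smul_right_injective _ (sub_ne_zero.2 hδ) ?_)
    have h₁ := hMab 1
    have h₂ := hMab δ
    simp only [map_one, one_smul, mul_add, add_mul, mul_smul_comm, smul_mul_assoc] at h₁ h₂
    simp only [Units.val_mul, sub_smul]
    linear_combination (norm := module) σ δ • h₁ - h₂
  refine ⟨M, ⟨m, rfl⟩, g⁻¹ * M⁻¹ * (S g)⁻¹, mem_glBase_of_fixed hfix ?_, by
    simp [S, mul_assoc]⟩
  change S _ = _
  simp only [map_mul, map_inv, hM, hS]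
  have h₃ : S g * M * g = g * M * S g := by
    have := congr(S g * $hMx * S g)
    simpa [x, y, mul_assoc] using this
  have := congrArg (·⁻¹) h₃
  simpa [mul_assoc] using this.symm

/-- The entrywise action of a field automorphism as an automorphism of `GL n k`. -/
def glAutEquiv (σ : k ≃ₐ[k₀] k) (n : ℕ) : GL (Fin n) k ≃* GL (Fin n) k :=
  Units.mapEquiv (σ.mapMatrix : Matrix (Fin n) (Fin n) k ≃ₐ[k₀] _).toRingEquiv.toMulEquiv

end GeneralLinear

/-- Let `k/k₀` be a quadratic extension of finite fields of characteristic `p`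
and `R` an algebraically closed field of characteristic `≠ p`.  If an irreducible
`R`-representation of `GL n k` has a nonzero `GL n k₀`-invariant linear form, then the space of
such forms is one-dimensional. -/
theorem distinguished_multiplicity_one
    (p : ℕ) [Fact p.Prime]
    (k₀ k : Type) [Field k₀] [Field k] [Fintype k₀] [Fintype k]
    [CharP k p] [Algebra k₀ k] (hquad : Module.finrank k₀ k = 2)
    (R : Type) [Field R] [IsAlgClosed R] (hchar : ringChar R ≠ p)
    (n : ℕ) (V : Type) [AddCommGroup V] [Module R V]
    (ρ : Representation R (GL (Fin n) k) V)
    (hirr : IsIrreducibleRep ρ)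
    (hdist : invariantForms ρ (glBase k₀ k n : Set (GL (Fin n) k)) ≠ ⊥) :
    Module.rank R ↥(invariantForms ρ (glBase k₀ k n : Set (GL (Fin n) k))) = 1 := by
  have : Finite (GL (Fin n) k) := inferInstance
  have hs := asAlgebraHom_surjective ρ hirr.1 hirr.2
  have := finiteDimensional_of_irreducible ρ hirr.2
  obtain ⟨σ, hinv, hfix, δ, hδ⟩ := exists_conjugation hquad
  obtain ⟨l, hl, hl0⟩ := Submodule.exists_mem_ne_zero_of_ne_bot hdist
  obtain ⟨v, hv0, hv⟩ := exists_fixed_of_invariantForms_ne_zero ρ hs _ (glInvTranspose n)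
    (isConj_inv_glInvTranspose n) (fun h hh => exists_inv_glInvTranspose_eq n hh) hl hl0
  rw [Module.rank_eq_one_iff_finrank_eq_one]
  refine finrank_eq_one (⟨l, hl⟩ : invariantForms ρ _) (fun h => hl0 congr(($h).1)) fun l' => ?_
  obtain ⟨c, hc⟩ := exists_smul_eq_of_fixed ρ hs _ (glAutEquiv σ n)
    (exists_inv_glAut_eq hinv hfix hδ) hv0 hv hl hl0 l'.2
  exact ⟨c, Subtype.ext hc⟩
end

section
/- Let k/k₀ be a quadratic extension of finite fields of characteristic p, σ the nontrivial k₀-automorphism of k acting entrywise on GL_n(k), and R an algebraically closed field of characteristic different from p. Let π be an irreducible R-representation of GL_n(k) such that Hom_{GL_n(k₀)}(π, 1) ≠ 0. Then the contragredient π^∨ also satisfies Hom_{GL_n(k₀)}(π^∨, 1) ≠ 0, and π is σ-selfdual, i.e. π ∘ σ is isomorphic to π^∨. -/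
open Matrix

section Intertwiners

variable {F M N X ι : Type*} [Ring F] [AddCommGroup M] [Module F M] [AddCommGroup N] [Module F N]
  [AddCommGroup X] [Module F X]

/-- The linear maps intertwining two families of endomorphisms. -/
def intertwiners (a : ι → Module.End F X) (b : ι → Module.End F M) : Set (X →ₗ[F] M) :=
  {f | ∀ i x, f (a i x) = b i (f x)}

variable [Finite M] [Finite N] [Finite X]
  (a : ι → Module.End F M) (b : ι → Module.End F N) (c : ι → Module.End F X)

theorem card_intertwiners_le_ker [Fintype (Submodule F X)] (K : Submodule F X)
    [DecidablePred (K ≤ ·)] :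
    Nat.card {f : intertwiners c a // K ≤ f.1.ker} =
      ∑ L with K ≤ L, Nat.card {f : intertwiners c a // f.1.ker = L} := by
  have : Finite (X →ₗ[F] M) := DFunLike.finite _
  rw [Finset.sum_subtype (p := (K ≤ ·)) _ (by simp), ← Nat.card_sigma]
  exact Nat.card_congr
    { toFun f := ⟨⟨f.1.1.ker, f.2⟩, f.1, rfl⟩
      invFun f := ⟨f.2.1, f.1.2.trans_eq f.2.2.symm⟩
      left_inv f := rfl
      right_inv := by
        rintro ⟨⟨L, hL⟩, f, hf⟩
        obtain rfl : f.1.ker = L := hf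
        rfl }

variable {a b c}

theorem card_intertwiners_le_ker_mono (e : (M × M) ≃ₗ[F] (N × N))
    (he : ∀ i u, e (a i u.1, a i u.2) = (b i (e u).1, b i (e u).2)) (K : Submodule F X) :
    Nat.card {f : intertwiners c a // K ≤ f.1.ker} ≤
      Nat.card {f : intertwiners c b // K ≤ f.1.ker} := by
  have : Finite (X →ₗ[F] M) := DFunLike.finite _
  have : Finite (X →ₗ[F] N) := DFunLike.finite _
  let P := {f : intertwiners c a // K ≤ f.1.ker}
  let g (f : P × P) : X →ₗ[F] N × N := e.toLinearMap ∘ₗ f.1.1.1.prod f.2.1.1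
  have hg (f : P × P) (i x) : g f (c i x) = (b i (g f x).1, b i (g f x).2) := by
    have h₁ := f.1.1.2 i x
    have h₂ := f.2.1.2 i x
    simp [g, h₁, h₂, ← he]
  have hK (f : P × P) (x) (hx : x ∈ K) : g f x = 0 := by
    have h₁ : f.1.1.1 x = 0 := f.1.2 hx
    have h₂ : f.2.1.1 x = 0 := f.2.2 hx
    simp [g, h₁, h₂]
  let E (f : P × P) :
      {f : intertwiners c b // K ≤ f.1.ker} × {f : intertwiners c b // K ≤ f.1.ker} :=
    (⟨⟨LinearMap.fst F N N ∘ₗ g f, fun i x ↦ by simp [hg]⟩, fun x hx ↦ by simp [hK f x hx]⟩,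
      ⟨⟨LinearMap.snd F N N ∘ₗ g f, fun i x ↦ by simp [hg]⟩, fun x hx ↦ by simp [hK f x hx]⟩)
  have hE : Function.Injective E := by
    intro f f' h
    have h' (x) : g f x = g f' x :=
      Prod.ext congr($h.1.1.1 x) congr($h.2.1.1 x)
    have h'' (x) : (f.1.1.1 x, f.2.1.1 x) = (f'.1.1.1 x, f'.2.1.1 x) := e.injective (h' x)
    ext x
    · exact congr($(h'' x).1)
    · exact congr($(h'' x).2)
  have := Nat.card_le_card_of_injective E hE
  rw [Nat.card_prod, Nat.card_prod] at this
  exact Nat.mul_self_le_mul_self_iff.mp this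

/-- Two families of endomorphisms of finite modules are simultaneously conjugate as soon as
their doubles are: finite modules have the square-root property for direct sums. -/
theorem exists_linearEquiv_of_prod_self (e : (M × M) ≃ₗ[F] (N × N))
    (he : ∀ i u, e (a i u.1, a i u.2) = (b i (e u).1, b i (e u).2)) :
    ∃ f : M ≃ₗ[F] N, ∀ i m, f (a i m) = b i (f m) := by
  classical
  have : Finite (M →ₗ[F] M) := DFunLike.finite _
  have : Finite (Submodule F M) :=
    Finite.of_injective (fun K ↦ (K : Set M)) SetLike.coe_injective
  have : Fintype (Submodule F M) := Fintype.ofFinite _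
  have hsymm (i u) : e.symm (b i u.1, b i u.2) = (a i (e.symm u).1, a i (e.symm u).2) := by
    rw [e.symm_apply_eq, he, e.apply_symm_apply]
  have hker (K : Submodule F M) : Nat.card {f : intertwiners a a // f.1.ker = K} =
      Nat.card {f : intertwiners a b // f.1.ker = K} := by
    induction K using WellFoundedGT.induction with
    | ind K ih =>
      have h := (card_intertwiners_le_ker_mono (c := a) e he K).antisymm
        (card_intertwiners_le_ker_mono e.symm hsymm K)
      have hK : K ∈ Finset.univ.filter (K ≤ ·) := by simp
      rw [card_intertwiners_le_ker, card_intertwiners_le_ker, ← Finset.add_sum_erase _ _ hK,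
        ← Finset.add_sum_erase _ _ hK, Finset.sum_congr rfl fun L hL ↦ ih L ?_] at h
      · exact Nat.add_right_cancel h
      · simp only [Finset.mem_erase, Finset.mem_filter, Finset.mem_univ, true_and] at hL
        exact lt_of_le_of_ne hL.2 (Ne.symm hL.1)
  have hpos : 0 < Nat.card {f : intertwiners a b // f.1.ker = ⊥} := by
    rw [← hker]
    have : Nonempty {f : intertwiners a a // f.1.ker = ⊥} :=
      ⟨⟨LinearMap.id, fun _ _ ↦ rfl⟩, LinearMap.ker_id⟩
    exact Nat.card_pos
  obtain ⟨⟨⟨f, hf⟩, hbot⟩⟩ := (Nat.card_pos_iff.mp hpos).1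
  have hcard : Nat.card M = Nat.card N := by
    have := Nat.card_congr e.toEquiv
    rw [Nat.card_prod, Nat.card_prod] at this
    exact Nat.mul_self_inj.mp this
  exact ⟨LinearEquiv.ofBijective f ((Nat.bijective_iff_injective_and_card f).mpr
    ⟨LinearMap.ker_eq_bot.mp hbot, hcard⟩), hf⟩

end Intertwiners

/-- If two families of matrices over `k₀` are simultaneously similar over a quadratic extension,
then they are simultaneously similar over `k₀`. -/
theorem exists_isUnit_base_intertwiner {k₀ k n ι : Type*} [Field k₀] [Field k] [Finite k₀]
    [Algebra k₀ k] (hquad : Module.finrank k₀ k = 2) [Fintype n] [DecidableEq n]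
    (a b : ι → Matrix n n k₀) (x : (Matrix n n k)ˣ)
    (hx : ∀ i, x * (a i).map (algebraMap k₀ k) = (b i).map (algebraMap k₀ k) * x) :
    ∃ h : (Matrix n n k₀)ˣ, ∀ i, h * a i = b i * h := by
  have : FiniteDimensional k₀ k := Module.finite_of_finrank_eq_succ hquad
  let β : k ≃ₗ[k₀] k₀ × k₀ := LinearEquiv.ofFinrankEq _ _ (by simp [hquad])
  let Ψ : (n → k) ≃ₗ[k₀] (n → k₀) × (n → k₀) :=
    { toFun u := (fun j ↦ (β (u j)).1, fun j ↦ (β (u j)).2)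
      invFun u j := β.symm (u.1 j, u.2 j)
      left_inv u := by ext; simp
      right_inv u := by ext <;> simp
      map_add' u v := by ext <;> simp
      map_smul' c u := by ext <;> simp }
  have hΨ (c : Matrix n n k₀) (u) :
      Ψ (c.map (algebraMap k₀ k) *ᵥ u) = (c *ᵥ (Ψ u).1, c *ᵥ (Ψ u).2) := by
    have key (j : n) : β ((c.map (algebraMap k₀ k) *ᵥ u) j) = ∑ l, c j l • β (u l) := by
      simp_rw [← map_smul, ← map_sum, Algebra.smul_def]
      rfl
    ext j
    · refine congr($(key j).1).trans ?_
      rw [Prod.fst_sum]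
      rfl
    · refine congr($(key j).2).trans ?_
      rw [Prod.snd_sum]
      rfl
  let X : (n → k) ≃ₗ[k₀] (n → k) :=
    { (Matrix.toLin' x.1).restrictScalars k₀ with
      invFun := Matrix.toLin' x.2
      left_inv u := by simp
      right_inv u := by simp }
  have hX (u) : X u = x.1 *ᵥ u := Matrix.toLin'_apply x.1 u
  obtain ⟨f, hf⟩ := exists_linearEquiv_of_prod_self (a := fun i ↦ (a i).toLin')
    (b := fun i ↦ (b i).toLin') (Ψ.symm ≪≫ₗ X ≪≫ₗ Ψ) fun i u ↦ by
      obtain ⟨u, rfl⟩ := Ψ.surjective u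
      simp only [Matrix.toLin'_apply, ← hΨ, LinearEquiv.trans_apply, LinearEquiv.symm_apply_apply,
        hX, Matrix.mulVec_mulVec, hx]
  refine ⟨⟨LinearMap.toMatrix' f.toLinearMap, LinearMap.toMatrix' f.symm.toLinearMap, ?_, ?_⟩,
    fun i ↦ ?_⟩
  · rw [← LinearMap.toMatrix'_comp]; simp
  · rw [← LinearMap.toMatrix'_comp]; simp
  · have : f.toLinearMap ∘ₗ (a i).toLin' = (b i).toLin' ∘ₗ f.toLinearMap :=
      LinearMap.ext fun m ↦ hf i m
    simpa [LinearMap.toMatrix'_comp] using congr(LinearMap.toMatrix' $this)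

section Quadratic

variable {k₀ k : Type} [Field k₀] [Field k] [Algebra k₀ k] {σ : k ≃ₐ[k₀] k}

theorem algEquiv_apply_apply_of_finrank_eq_two [Finite k] (hquad : Module.finrank k₀ k = 2)
    (z : k) : σ (σ z) = z := by
  have : FiniteDimensional k₀ k := Module.finite_of_finrank_eq_succ hquad
  have : Finite k₀ := .of_injective _ (algebraMap k₀ k).injective
  have hcard : Nat.card (k ≃ₐ[k₀] k) = 2 := by rw [IsGalois.card_aut_eq_finrank, hquad]
  have : σ ^ 2 = 1 := hcard ▸ pow_card_eq_one'
  simpa [pow_two] using congr($this z)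

theorem exists_algebraMap_eq_of_finrank_eq_two [Finite k] (hquad : Module.finrank k₀ k = 2)
    (hσ : σ ≠ AlgEquiv.refl) {z : k} (hz : σ z = z) :
    ∃ y, algebraMap k₀ k y = z := by
  have : FiniteDimensional k₀ k := Module.finite_of_finrank_eq_succ hquad
  have : Finite k₀ := .of_injective _ (algebraMap k₀ k).injective
  have hcard : Nat.card (k ≃ₐ[k₀] k) = 2 := by rw [IsGalois.card_aut_eq_finrank, hquad]
  refine (IsGalois.mem_range_algebraMap_iff_fixed (F := k₀) z).mpr fun τ ↦ ?_
  by_cases hτ : τ = 1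
  · rw [hτ, AlgEquiv.one_apply]
  · rw [((Nat.card_eq_two_iff' 1).mp hcard).unique hτ hσ, hz]

variable {n : ℕ}

theorem glAut_of_mem_glBase {g : GL (Fin n) k} (hg : g ∈ glBase k₀ k n) :
    glAut k₀ k σ n g = g := by
  obtain ⟨h, rfl⟩ := hg
  ext i j
  exact σ.commutes _

theorem glAut_glAut [Finite k] (hquad : Module.finrank k₀ k = 2) (g : GL (Fin n) k) :
    glAut k₀ k σ n (glAut k₀ k σ n g) = g := by
  ext i j
  exact algEquiv_apply_apply_of_finrank_eq_two hquad _

theorem mem_glBase_of_glAut_eq [Finite k] (hquad : Module.finrank k₀ k = 2)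
    (hσ : σ ≠ AlgEquiv.refl) {g : GL (Fin n) k} (hg : glAut k₀ k σ n g = g) : g ∈ glBase k₀ k n := by
  have key (u : GL (Fin n) k) (hu : glAut k₀ k σ n u = u) :
      ∃ A : Matrix (Fin n) (Fin n) k₀, (algebraMap k₀ k).mapMatrix A = u.1 := by
    choose A hA using fun i j ↦ exists_algebraMap_eq_of_finrank_eq_two hquad hσ
      (z := u.1 i j) congr(($hu).1 i j)
    exact ⟨A, Matrix.ext hA⟩
  obtain ⟨A, hA⟩ := key g hg
  obtain ⟨A', hA'⟩ := key g⁻¹ (by rw [map_inv, hg])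
  have hinj : Function.Injective ((algebraMap k₀ k).mapMatrix (m := Fin n)) :=
    Matrix.map_injective (algebraMap k₀ k).injective
  refine ⟨⟨A, A', hinj ?_, hinj ?_⟩, Units.ext hA⟩
  · rw [map_mul, hA, hA', map_one, ← Units.val_mul, mul_inv_cancel, Units.val_one]
  · rw [map_mul, hA, hA', map_one, ← Units.val_mul, inv_mul_cancel, Units.val_one]

/-- Two matrices `s` and `t` satisfying `s * σ s = 1` and `t * σ t = 1` which are conjugate under
`GL n k` are conjugate under `GL n k₀`. -/
theorem exists_mem_glBase_conj [Finite k] (hquad : Module.finrank k₀ k = 2)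
    (hσ : σ ≠ AlgEquiv.refl) {s t x : GL (Fin n) k} (hs : s * glAut k₀ k σ n s = 1)
    (ht : t * glAut k₀ k σ n t = 1) (hx : x * t = s * x) :
    ∃ h ∈ glBase k₀ k n, h * t = s * h := by
  have : Finite k₀ := .of_injective _ (algebraMap k₀ k).injective
  choose tr htr using fun z ↦ exists_algebraMap_eq_of_finrank_eq_two hquad hσ (z := z + σ z)
    (by rw [map_add, algEquiv_apply_apply_of_finrank_eq_two hquad, add_comm])
  obtain ⟨α, hα⟩ : ∃ α, σ α ≠ α := by
    by_contra! h
    exact hσ (AlgEquiv.ext h)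
  have hx' : x * glAut k₀ k σ n t = glAut k₀ k σ n s * x := by
    rw [eq_inv_of_mul_eq_one_right hs, eq_inv_of_mul_eq_one_right ht, mul_inv_eq_iff_eq_mul,
      mul_assoc, hx, inv_mul_cancel_left]
  let a (g : GL (Fin n) k) (c : k) : Matrix (Fin n) (Fin n) k₀ := g.1.map fun z ↦ tr (c * z)
  have ha (g c) : (a g c).map (algebraMap k₀ k) = c • g.1 + σ c • (glAut k₀ k σ n g).1 := by
    ext i j
    simp [a, htr, glAut]
  have hxv := congr(($hx).1)
  have hxv' := congr(($hx').1)
  simp only [Units.val_mul] at hxv hxv'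
  obtain ⟨h, hh⟩ := exists_isUnit_base_intertwiner hquad (a t) (a s) x fun c ↦ by
    simp [ha, mul_add, add_mul, hxv, hxv']
  refine ⟨_, ⟨h, rfl⟩, ?_⟩
  ext1
  set H : Matrix (Fin n) (Fin n) k := h.1.map (algebraMap k₀ k)
  have hH (c : k) := congr(($(hh c)).map (algebraMap k₀ k))
  simp only [Matrix.map_mul, ha] at hH
  have h₁ := hH 1
  have hα' := hH α
  simp only [mul_add, add_mul, mul_smul_comm, smul_mul_assoc, map_one, one_smul] at h₁ hα'
  change H * t.1 = s.1 * H
  have hne : α - σ α ≠ 0 := sub_ne_zero.mpr hα.symm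
  refine smul_right_injective _ hne ?_
  change (α - σ α) • _ = (α - σ α) • _
  rw [sub_smul, sub_smul]
  have h₂ := congr(σ α • $h₁)
  rw [smul_add, smul_add] at h₂
  have h₃ := congr($hα' - $h₂)
  rwa [add_sub_add_right_eq_sub, add_sub_add_right_eq_sub] at h₃

/-- The anti-involution `g ↦ (σ g)⁻¹` preserves each double coset of `GL n k₀`. -/
theorem exists_mem_glBase_mul_mul [Finite k] (hquad : Module.finrank k₀ k = 2)
    (hσ : σ ≠ AlgEquiv.refl) (g : GL (Fin n) k) :
    ∃ h ∈ glBase k₀ k n, ∃ h' ∈ glBase k₀ k n, (glAut k₀ k σ n g)⁻¹ = h * g * h' := by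
  set g' := glAut k₀ k σ n g with hg'
  obtain ⟨h, hmem, hh⟩ := exists_mem_glBase_conj hquad hσ (s := g * g'⁻¹) (t := g'⁻¹ * g) (x := g)
    (by simp [hg', glAut_glAut hquad]) (by simp [hg', glAut_glAut hquad]) (by group)
  refine ⟨h⁻¹, inv_mem hmem, g⁻¹ * h * g'⁻¹, mem_glBase_of_glAut_eq hquad hσ ?_, by group⟩
  rw [map_mul, map_mul, map_inv, map_inv, ← hg', hg', glAut_glAut hquad, glAut_of_mem_glBase hmem,
    ← hg', mul_inv_eq_iff_eq_mul, mul_assoc, mul_assoc, hh]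
  group

end Quadratic

open Polynomial in
/-- `M` carries a nondegenerate bilinear form for which `X` is self-adjoint. -/
def HasSelfAdjointForm (K M : Type*) [Field K] [AddCommGroup M] [Module K M] [Module K[X] M] :
    Prop :=
  ∃ B : M →ₗ[K] M →ₗ[K] K, (∀ a, (∀ b, B a b = 0) → a = 0) ∧
    ∀ a b, B ((X : K[X]) • a) b = B a ((X : K[X]) • b)

open Polynomial in
theorem HasSelfAdjointForm.of_linearEquiv {K M N : Type*} [Field K] [AddCommGroup M] [Module K M]
    [Module K[X] M] [IsScalarTower K K[X] M] [AddCommGroup N] [Module K N] [Module K[X] N]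
    [IsScalarTower K K[X] N] (e : M ≃ₗ[K[X]] N) (h : HasSelfAdjointForm K N) :
    HasSelfAdjointForm K M := by
  obtain ⟨B, hB, hX⟩ := h
  refine ⟨B.compl₁₂ (e.toLinearMap.restrictScalars K) (e.toLinearMap.restrictScalars K),
    fun a ha ↦ ?_, fun a b ↦ by simp [hX]⟩
  refine e.map_eq_zero_iff.mp (hB _ fun b ↦ ?_)
  simpa using ha (e.symm b)

open Polynomial in
theorem hasSelfAdjointForm_quotient_of_monic {K : Type*} [Field K] (f : K[X]) (hf : f.Monic) :
    HasSelfAdjointForm K (K[X] ⧸ Ideal.span {f}) := by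
  let φ : (K[X] ⧸ Ideal.span {f}) →ₗ[K] K[X] := AdjoinRoot.modByMonicHom hf
  have hφ (q : K[X]) : φ (Ideal.Quotient.mk _ q) = q %ₘ f := AdjoinRoot.modByMonicHom_mk hf q
  refine ⟨(LinearMap.mul K (K[X] ⧸ Ideal.span {f})).compr₂
    (lcoeff K (f.natDegree - 1) ∘ₗ φ), fun a ha ↦ ?_, fun a b ↦ ?_⟩
  swap
  · rw [LinearMap.compr₂_apply, LinearMap.compr₂_apply, LinearMap.mul_apply', LinearMap.mul_apply',
      smul_mul_assoc, mul_smul_comm]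
  by_contra h0
  set r := φ a with hr
  have har : Ideal.Quotient.mk _ r = a := AdjoinRoot.mk_leftInverse hf a
  have hr0 : r ≠ 0 := fun h ↦ h0 (by rw [← har, h, map_zero])
  have hdeg : r.degree < f.degree := by
    obtain ⟨q, rfl⟩ := Ideal.Quotient.mk_surjective a
    rw [hr, hφ]
    exact degree_modByMonic_lt _ hf
  have hnat : r.natDegree < f.natDegree := natDegree_lt_natDegree hr0 hdeg
  have h := ha (Ideal.Quotient.mk _ (X ^ (f.natDegree - 1 - r.natDegree)))
  rw [← har] at h
  simp only [LinearMap.compr₂_apply, LinearMap.mul_apply', ← map_mul, LinearMap.comp_apply,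
    hφ, lcoeff_apply] at h
  rw [(modByMonic_eq_self_iff hf).mpr] at h
  · have h' := coeff_mul_X_pow r (f.natDegree - 1 - r.natDegree) r.natDegree
    rw [show r.natDegree + (f.natDegree - 1 - r.natDegree) = f.natDegree - 1 by omega, h] at h'
    exact hr0 (leadingCoeff_eq_zero.mp h'.symm)
  · apply degree_lt_degree
    rw [natDegree_mul_X_pow _ hr0]
    omega

open Polynomial in
theorem hasSelfAdjointForm_quotient {K : Type*} [Field K] (f : K[X]) (hf : f ≠ 0) :
    HasSelfAdjointForm K (K[X] ⧸ Submodule.span K[X] {f}) := by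
  classical
  exact .of_linearEquiv (N := K[X] ⧸ Ideal.span {normalize f})
    (Submodule.quotEquivOfEq _ _ (Ideal.span_singleton_eq_span_singleton.mpr
      (normalize_associated f).symm))
    (hasSelfAdjointForm_quotient_of_monic _ (monic_normalize hf))

open Polynomial DirectSum in
theorem HasSelfAdjointForm.directSum {K ι : Type*} [Field K] [Fintype ι] (M : ι → Type*)
    [∀ i, AddCommGroup (M i)] [∀ i, Module K (M i)] [∀ i, Module K[X] (M i)]
    (h : ∀ i, HasSelfAdjointForm K (M i)) : HasSelfAdjointForm K (⨁ i, M i) := by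
  classical
  choose B hB hX using h
  refine ⟨∑ i, (B i).compl₁₂ (DirectSum.component K ι M i) (DirectSum.component K ι M i),
    fun a ha ↦ ?_, fun a b ↦ ?_⟩
  · ext i
    refine hB i _ fun b ↦ ?_
    have := ha (DirectSum.lof K ι M i b)
    simp only [LinearMap.sum_apply, LinearMap.compl₁₂_apply] at this
    rw [Finset.sum_eq_single i] at this
    · rw [DirectSum.component.lof_self] at this
      exact this
    · intro j _ hj
      rw [DirectSum.component.of, dif_neg hj.symm, map_zero]
    · simp
  · simp only [LinearMap.sum_apply, LinearMap.compl₁₂_apply]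
    refine Finset.sum_congr rfl fun i _ ↦ ?_
    exact hX i (a i) (b i)

open Polynomial in
/-- Every square matrix over a field is similar to its transpose. -/
theorem Matrix.exists_isUnit_transpose_mul_eq {K n : Type*} [Field K] [Fintype n] [DecidableEq n]
    (A : Matrix n n K) : ∃ P : Matrix n n K, IsUnit P ∧ A.transpose * P = P * A := by
  have htors : Module.IsTorsion K[X] (Module.AEval' A.toLin') := fun {m} ↦
    ⟨⟨A.charpoly, mem_nonZeroDivisors_of_ne_zero A.charpoly_monic.ne_zero⟩, by
      refine (Module.AEval'.of A.toLin').symm.map_eq_zero_iff.mp ?_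
      rw [Submonoid.mk_smul, Module.AEval'.of, Module.AEval.of_symm_smul,
        ← Matrix.charpoly_toLin', LinearMap.aeval_self_charpoly, zero_smul]⟩
  obtain ⟨B, hB, hX⟩ : HasSelfAdjointForm K (Module.AEval' A.toLin') := by
    obtain ⟨ι, _, p, hp, e, ⟨E⟩⟩ := Module.equiv_directSum_of_isTorsion htors
    exact .of_linearEquiv E (.directSum _ fun i ↦
      hasSelfAdjointForm_quotient _ (pow_ne_zero _ (hp i).ne_zero))
  let u := Module.AEval'.of A.toLin'
  let B' : (n → K) →ₗ[K] (n → K) →ₗ[K] K := B.compl₁₂ u.toLinearMap u.toLinearMap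
  have hB' (a) (ha : ∀ b, B' a b = 0) : a = 0 :=
    u.map_eq_zero_iff.mp (hB _ fun b ↦ by simpa [B'] using ha (u.symm b))
  have hA (a b) : B' (A *ᵥ a) b = B' a (A *ᵥ b) := by
    simpa [u, B', Module.AEval'.X_smul_of] using hX (u a) (u b)
  refine ⟨LinearMap.toMatrix₂' K B', ?_, ?_⟩
  · rwa [Matrix.isUnit_iff_isUnit_det, isUnit_iff_ne_zero, ← Matrix.separatingLeft_iff_det_ne_zero,
      LinearMap.separatingLeft_toMatrix₂'_iff]
  · have : B'.comp A.toLin' = B'.compl₂ A.toLin' := LinearMap.ext₂ fun a b ↦ hA a b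
    have := congr(LinearMap.toMatrix₂' K $this)
    rwa [LinearMap.toMatrix₂'_comp, LinearMap.toMatrix₂'_compl₂, LinearMap.toMatrix'_toLin'] at this

section Irreducible

variable {R G V W : Type} [Field R] [Group G] [AddCommGroup V] [Module R V] [AddCommGroup W]
  [Module R W] {ρ : Representation R G V} {τ : Representation R G W}

theorem IsIrreducibleRep.exists_ne_zero (h : IsIrreducibleRep ρ) : ∃ v : V, v ≠ 0 := by
  obtain ⟨v, -, hv⟩ := (Submodule.ne_bot_iff _).mp h.1.symm
  exact ⟨v, hv⟩

theorem IsIrreducibleRep.finiteDimensional [Finite G] (h : IsIrreducibleRep ρ) :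
    FiniteDimensional R V := by
  obtain ⟨v, hv⟩ := h.exists_ne_zero
  have htop := (h.2 (Submodule.span R (Set.range fun g ↦ ρ g v)) fun g w hw ↦ ?_).resolve_left ?_
  · exact ⟨htop ▸ Submodule.fg_span (Set.finite_range _)⟩
  · induction hw using Submodule.span_induction with
    | mem x hx =>
      obtain ⟨g', rfl⟩ := hx
      exact Submodule.subset_span ⟨g * g', by simp⟩
    | zero => simp
    | add x y _ _ hx hy => simpa using add_mem hx hy
    | smul c x _ hx => simpa using Submodule.smul_mem _ c hx
  · refine fun hbot ↦ hv ?_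
    have : v ∈ Submodule.span R (Set.range fun g ↦ ρ g v) :=
      Submodule.subset_span ⟨1, by simp⟩
    rwa [hbot, Submodule.mem_bot] at this

/-- A nonzero equivariant map between irreducible representations is an isomorphism. -/
theorem IsIrreducibleRep.bijective_of_ne_zero (hρ : IsIrreducibleRep ρ) (hτ : IsIrreducibleRep τ)
    (f : V →ₗ[R] W) (hf : ∀ g v, f (ρ g v) = τ g (f v)) (hne : f ≠ 0) :
    Function.Bijective f := by
  constructor
  · refine LinearMap.ker_eq_bot.mp ((hρ.2 f.ker fun g v hv ↦ ?_).resolve_right fun h ↦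
      hne (LinearMap.ker_eq_top.mp h))
    rw [LinearMap.mem_ker] at hv ⊢
    rw [hf, hv, map_zero]
  · refine LinearMap.range_eq_top.mp ((hτ.2 f.range ?_).resolve_left fun h ↦
      hne (LinearMap.range_eq_bot.mp h))
    rintro g _ ⟨v, rfl⟩
    exact ⟨ρ g v, hf g v⟩

/-- Burnside's theorem: the group algebra surjects onto the endomorphism algebra of an irreducible
representation. -/
theorem IsIrreducibleRep.asAlgebraHom_surjective [IsAlgClosed R] [FiniteDimensional R V]
    (h : IsIrreducibleRep ρ) : Function.Surjective ρ.asAlgebraHom := by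
  have : ρ.IsIrreducible :=
    { exists_pair_ne := ⟨⊥, ⊤, fun hbt ↦ h.1 congr(($hbt).toSubmodule)⟩
      eq_bot_or_eq_top := fun W ↦ (h.2 W.1 W.2).imp
        (fun hW ↦ Subrepresentation.toSubmodule_injective hW)
        (fun hW ↦ Subrepresentation.toSubmodule_injective hW) }
  have : IsSimpleModule (MonoidAlgebra R G) ρ.asModule :=
    ρ.irreducible_iff_isSimpleModule_asModule.mp this
  have : FiniteDimensional R ρ.asModule := ‹FiniteDimensional R V›
  intro f
  let f' : Module.End (Module.End (MonoidAlgebra R G) ρ.asModule) ρ.asModule :=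
    { toFun := fun m ↦ ρ.asModuleEquiv.symm (f (ρ.asModuleEquiv m))
      map_add' := fun a b ↦ by simp
      map_smul' := fun φ a ↦ by
        obtain ⟨c, rfl⟩ :=
          (IsSimpleModule.algebraMap_end_bijective_of_isAlgClosed (A := MonoidAlgebra R G)
            (V := ρ.asModule) R).2 φ
        simp }
  obtain ⟨s, hs⟩ := (Module.finite_def (R := R) (M := ρ.asModule)).mp inferInstance
  obtain ⟨r, hr⟩ := jacobson_density f' s
  refine ⟨r, LinearMap.ext_on (s := ρ.asModuleEquiv '' s) ?_ ?_⟩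
  · refine (Submodule.map_span ρ.asModuleEquiv.toLinearMap s).symm.trans ?_
    rw [hs, Submodule.map_top, LinearEquiv.range]
  · rintro _ ⟨m, hm, rfl⟩
    rw [← ρ.asModuleEquiv_map_smul, ← hr m hm]
    simp [f']

/-- Irreducible finite-dimensional representations over an algebraically closed field are determined
by their characters, in any characteristic. -/
theorem IsIrreducibleRep.repIso_of_trace_eq [IsAlgClosed R] [FiniteDimensional R V]
    [FiniteDimensional R W] (hρ : IsIrreducibleRep ρ) (hτ : IsIrreducibleRep τ)
    (htr : ∀ g, LinearMap.trace R V (ρ g) = LinearMap.trace R W (τ g)) : RepIso ρ τ := by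
  have htr' (a : MonoidAlgebra R G) :
      LinearMap.trace R V (ρ.asAlgebraHom a) = LinearMap.trace R W (τ.asAlgebraHom a) := by
    induction a using MonoidAlgebra.induction_on with
    | of g => simp [htr]
    | add x y hx hy => simp only [map_add, hx, hy]
    | smul r x hx => simp only [map_smul, hx]
  have hker (a : MonoidAlgebra R G) (ha : ρ.asAlgebraHom a = 0) : τ.asAlgebraHom a = 0 := by
    ext w
    refine (Module.forall_dual_apply_eq_zero_iff R _).mp fun φ ↦ ?_
    obtain ⟨b, hb⟩ := hτ.asAlgebraHom_surjective (φ.smulRight w)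
    have := htr' (a * b)
    have hmul : φ.smulRight (τ.asAlgebraHom a w) = τ.asAlgebraHom a * φ.smulRight w := by
      ext
      simp
    rw [map_mul ρ.asAlgebraHom, map_mul τ.asAlgebraHom, ha, zero_mul, map_zero, hb, ← hmul,
      LinearMap.trace_smulRight] at this
    exact this.symm
  obtain ⟨i, hi⟩ := ρ.asAlgebraHom.toLinearMap.exists_rightInverse_of_surjective
    (LinearMap.range_eq_top.mpr hρ.asAlgebraHom_surjective)
  let S : Module.End R V →ₗ[R] Module.End R W := τ.asAlgebraHom.toLinearMap ∘ₗ i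
  have hS (a : MonoidAlgebra R G) : S (ρ.asAlgebraHom a) = τ.asAlgebraHom a := by
    refine sub_eq_zero.mp ((map_sub τ.asAlgebraHom _ _).symm.trans (hker _ ?_))
    rw [map_sub, sub_eq_zero]
    exact congr($hi (ρ.asAlgebraHom a))
  obtain ⟨u, hu⟩ := hρ.exists_ne_zero
  obtain ⟨φ, hφ⟩ := Module.Projective.exists_dual_eq_one R hu
  obtain ⟨w, hw⟩ : ∃ w, S (φ.smulRight u) w ≠ 0 := by
    by_contra! hw
    obtain ⟨a, ha⟩ := hρ.asAlgebraHom_surjective (φ.smulRight u)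
    have := htr' a
    rw [← hS, ha, LinearMap.trace_smulRight, hφ,
      show S (φ.smulRight u) = 0 from LinearMap.ext hw, map_zero] at this
    exact one_ne_zero this
  let f : V →ₗ[R] W := (LinearMap.applyₗ w ∘ₗ S) ∘ₗ LinearMap.smulRightₗ φ
  have hf (v) : f v = S (φ.smulRight v) w := rfl
  have hfg (g v) : f (ρ g v) = τ g (f v) := by
    obtain ⟨a, ha⟩ := hρ.asAlgebraHom_surjective (φ.smulRight v)
    have : φ.smulRight (ρ g v) = ρ.asAlgebraHom (MonoidAlgebra.single g 1 * a) := by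
      rw [map_mul, ha, Representation.asAlgebraHom_single_one]
      ext
      simp
    rw [hf, hf, this, hS, ← ha, hS, map_mul, Representation.asAlgebraHom_single_one]
    rfl
  exact ⟨.ofBijective f (hρ.bijective_of_ne_zero hτ f hfg fun h0 ↦ hw congr($h0 u)), hfg⟩

end Irreducible

section Transpose

variable {R k V : Type} [Field R] [Field k] [AddCommGroup V] [Module R V] {n : ℕ}

/-- The transpose of an invertible matrix. -/
def glTranspose (g : GL (Fin n) k) : GL (Fin n) k where
  val := g.1.transpose
  inv := g.2.transpose
  val_inv := by rw [← Matrix.transpose_mul, g.4, Matrix.transpose_one]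
  inv_val := by rw [← Matrix.transpose_mul, g.3, Matrix.transpose_one]

theorem glTranspose_one : glTranspose (1 : GL (Fin n) k) = 1 :=
  Units.ext Matrix.transpose_one

theorem glTranspose_mul (g h : GL (Fin n) k) :
    glTranspose (g * h) = glTranspose h * glTranspose g :=
  Units.ext (Matrix.transpose_mul _ _)

theorem glTranspose_glTranspose (g : GL (Fin n) k) : glTranspose (glTranspose g) = g :=
  Units.ext (Matrix.transpose_transpose _)

theorem glTranspose_mem_glBase {k₀ : Type} [Field k₀] [Algebra k₀ k] {g : GL (Fin n) k}
    (hg : g ∈ glBase k₀ k n) : glTranspose g ∈ glBase k₀ k n := by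
  obtain ⟨h, rfl⟩ := hg
  exact ⟨glTranspose h, Units.ext Matrix.transpose_map⟩

theorem exists_glTranspose_eq_conj (g : GL (Fin n) k) :
    ∃ x : GL (Fin n) k, glTranspose g = x * g * x⁻¹ := by
  obtain ⟨_, ⟨x, rfl⟩, hx⟩ := Matrix.exists_isUnit_transpose_mul_eq g.1
  exact ⟨x, eq_mul_inv_of_mul_eq (Units.ext hx)⟩

/-- The representation of `GL n k` on the dual space of `V` given by precomposition with `ρ gᵀ`. -/
def transposeDual (ρ : Representation R (GL (Fin n) k) V) :
    Representation R (GL (Fin n) k) (Module.Dual R V) where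
  toFun g := Module.Dual.transpose (ρ (glTranspose g))
  map_one' := by
    rw [glTranspose_one, map_one]
    rfl
  map_mul' g h := by
    rw [glTranspose_mul, map_mul]
    rfl

variable {ρ : Representation R (GL (Fin n) k) V}

theorem transposeDual_apply_apply (g : GL (Fin n) k) (φ : Module.Dual R V) (v : V) :
    transposeDual ρ g φ v = φ (ρ (glTranspose g) v) := rfl

theorem IsIrreducibleRep.transposeDual [FiniteDimensional R V] (h : IsIrreducibleRep ρ) :
    IsIrreducibleRep (transposeDual ρ) := by
  obtain ⟨v, hv⟩ := h.exists_ne_zero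
  obtain ⟨φ, hφ⟩ := Module.Projective.exists_dual_ne_zero R hv
  refine ⟨fun hbt ↦ hφ ?_, fun W hW ↦ ?_⟩
  · have : φ ∈ (⊥ : Submodule R (Module.Dual R V)) := hbt ▸ Submodule.mem_top
    rw [(Submodule.mem_bot R).mp this, LinearMap.zero_apply]
  · have hinv := h.2 W.dualCoannihilator fun g v hv ↦ ?_
    · rw [← Subspace.dualCoannihilator_dualAnnihilator_eq (W := W)]
      rcases hinv with h' | h' <;> simp [h']
    · rw [Submodule.mem_dualCoannihilator] at hv ⊢
      intro φ hφ
      have := hv _ (hW (glTranspose g) φ hφ)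
      rwa [transposeDual_apply_apply, glTranspose_glTranspose] at this

theorem IsIrreducibleRep.repIso_transposeDual [IsAlgClosed R] [FiniteDimensional R V]
    (h : IsIrreducibleRep ρ) : RepIso ρ (_root_.transposeDual ρ) := by
  refine h.repIso_of_trace_eq h.transposeDual fun g ↦ ?_
  obtain ⟨x, hx⟩ := exists_glTranspose_eq_conj g
  change _ = LinearMap.trace R _ (Module.Dual.transpose (ρ (glTranspose g)))
  rw [LinearMap.trace_transpose', hx, map_mul ρ, LinearMap.trace_mul_comm, ← map_mul ρ,
    ← mul_assoc, inv_mul_cancel, one_mul]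

/-- An irreducible representation with a nonzero `GL n k₀`-invariant form has a nonzero
`GL n k₀`-fixed vector. -/
theorem IsIrreducibleRep.exists_fixed_vector [IsAlgClosed R] [FiniteDimensional R V]
    {k₀ : Type} [Field k₀] [Algebra k₀ k] (h : IsIrreducibleRep ρ) {φ : V →ₗ[R] R} (hφ : φ ≠ 0)
    (hmem : φ ∈ invariantForms ρ (glBase k₀ k n : Set (GL (Fin n) k))) :
    ∃ v ≠ 0, ∀ g ∈ glBase k₀ k n, ρ g v = v := by
  obtain ⟨e, he⟩ := h.repIso_transposeDual
  refine ⟨e.symm φ, e.symm.map_ne_zero_iff.mpr hφ, fun g hg ↦ e.injective ?_⟩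
  rw [he, e.apply_symm_apply]
  exact LinearMap.ext fun v ↦ hmem _ (glTranspose_mem_glBase hg) v

end Transpose

theorem invariantForms_dual_ne_bot {R G V : Type} [Field R] [Group G] [AddCommGroup V] [Module R V]
    {ρ : Representation R G V} {H : Subgroup G} {v : V} (hv : v ≠ 0) (hH : ∀ g ∈ H, ρ g v = v) :
    invariantForms ρ.dual (H : Set G) ≠ ⊥ := by
  refine (Submodule.ne_bot_iff _).mpr ⟨Module.Dual.eval R V v, fun g hg φ ↦ ?_, fun h ↦ hv ?_⟩
  · exact congr(φ $(hH _ (inv_mem hg)))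
  · exact (Module.forall_dual_apply_eq_zero_iff R v).mp fun φ ↦ congr($h φ)

/-- Let `θ` be an involution of `G` such that `g ↦ (θ g)⁻¹` preserves the double cosets of `H`.
If an irreducible representation of `G` has a nonzero `H`-invariant form and a nonzero
`H`-fixed vector, then its twist by `θ` is isomorphic to its contragredient. -/
theorem IsIrreducibleRep.repIso_comp_dual {R G V : Type} [Field R] [Group G] [AddCommGroup V]
    [Module R V] [FiniteDimensional R V] {ρ : Representation R G V} (h : IsIrreducibleRep ρ)
    {H : Subgroup G} {θ : G →* G} (hθ : ∀ g, θ (θ g) = g)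
    (hH : ∀ g, ∃ h ∈ H, ∃ h' ∈ H, (θ g)⁻¹ = h * g * h') {φ : V →ₗ[R] R} (hφ : φ ≠ 0)
    (hφH : φ ∈ invariantForms ρ (H : Set G)) {v : V} (hv : v ≠ 0) (hvH : ∀ g ∈ H, ρ g v = v) :
    RepIso (ρ.comp θ) ρ.dual := by
  let Φ : V →ₗ[R] G → R := LinearMap.pi fun g ↦ φ ∘ₗ ρ g
  let Ψ : Module.Dual R V →ₗ[R] G → R :=
    LinearMap.pi fun g ↦ Module.Dual.eval R V (ρ (θ g)⁻¹ v)
  have hΦ_apply (u g) : Φ u g = φ (ρ g u) := rfl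
  have hΨ_apply (μ g) : Ψ μ g = μ (ρ (θ g)⁻¹ v) := rfl
  have hΦ_mul (x u g) : Φ (ρ x u) g = Φ u (g * x) := by simp [hΦ_apply]
  have hΨ_mul (x μ g) : Ψ (ρ.dual (θ x) μ) g = Ψ μ (g * x) := by
    rw [hΨ_apply, hΨ_apply, map_mul, _root_.mul_inv_rev, map_mul]
    rfl
  have hΦ : Function.Injective Φ := by
    refine LinearMap.ker_eq_bot.mp ((h.2 Φ.ker fun x u hu ↦ ?_).resolve_right fun htop ↦ hφ ?_)
    · rw [LinearMap.mem_ker] at hu ⊢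
      ext g
      rw [hΦ_mul, hu, Pi.zero_apply, Pi.zero_apply]
    · ext u
      simpa [hΦ_apply] using congr($(LinearMap.ker_eq_top.mp htop) u 1)
  have hΨ : Function.Injective Ψ := by
    refine (injective_iff_map_eq_zero _).mpr fun μ hμ ↦ LinearMap.ker_eq_top.mp ?_
    have hle : ⨅ g, (μ ∘ₗ ρ g).ker ≤ μ.ker := fun u hu ↦ by
      simpa using (Submodule.mem_iInf _).mp hu 1
    refine top_le_iff.mp (((h.2 (⨅ g, (μ ∘ₗ ρ g).ker) fun x u hu ↦ ?_).resolve_left fun hbot ↦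
      hv ?_).ge.trans hle)
    · refine (Submodule.mem_iInf _).mpr fun g ↦ ?_
      simpa using (Submodule.mem_iInf _).mp hu (g * x)
    · rw [← Submodule.mem_bot R, ← hbot]
      refine (Submodule.mem_iInf _).mpr fun g ↦ ?_
      simpa [hΨ_apply, hθ] using congr($hμ (θ g⁻¹))
  have hΦΨ : Φ v = Ψ φ := by
    ext g
    obtain ⟨a, ha, b, hb, hab⟩ := hH g
    rw [hΦ_apply, hΨ_apply, hab, map_mul, map_mul, Module.End.mul_apply, Module.End.mul_apply,
      hvH b hb, hφH a ha]
  have hrange (u) : Φ u ∈ Ψ.range := by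
    have htop := (h.2 (Ψ.range.comap Φ) ?_).resolve_left fun hbot ↦ hv ?_
    · exact htop.ge (Submodule.mem_top (x := u))
    · rintro x u ⟨μ, hμ⟩
      exact ⟨ρ.dual (θ x) μ, funext fun g ↦ by rw [hΨ_mul, hΦ_mul, hμ]⟩
    · rw [← Submodule.mem_bot R, ← hbot]
      exact ⟨φ, hΦΨ.symm⟩
  let f : V →ₗ[R] Module.Dual R V :=
    (LinearEquiv.ofInjective Ψ hΨ).symm.toLinearMap ∘ₗ Φ.codRestrict Ψ.range hrange
  have hf (u) : Ψ (f u) = Φ u :=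
    congr(($((LinearEquiv.ofInjective Ψ hΨ).apply_symm_apply ⟨Φ u, hrange u⟩)).1)
  have hf_inj : Function.Injective f := fun a b hab ↦ hΦ (by rw [← hf, ← hf, hab])
  refine ⟨f.linearEquivOfInjective hf_inj Subspace.dual_finrank_eq.symm, fun x u ↦ hΨ ?_⟩
  ext g
  rw [LinearMap.linearEquivOfInjective_apply, LinearMap.linearEquivOfInjective_apply, hf]
  conv_rhs => rw [← hθ x, hΨ_mul, hf]
  exact hΦ_mul _ _ _

/-- A `GL n k₀`-distinguished irreducible representation of `GL n k` has
distinguished contragredient, and is σ-selfdual. -/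
theorem distinguished_selfdual
    (p : ℕ) [Fact p.Prime]
    (k₀ k : Type) [Field k₀] [Field k] [Fintype k₀] [Fintype k]
    [CharP k p] [Algebra k₀ k] (hquad : Module.finrank k₀ k = 2)
    (σ : k ≃ₐ[k₀] k) (hσ : σ ≠ AlgEquiv.refl)
    (R : Type) [Field R] [IsAlgClosed R] (hchar : ringChar R ≠ p)
    (n : ℕ) (V : Type) [AddCommGroup V] [Module R V]
    (ρ : Representation R (GL (Fin n) k) V)
    (hirr : IsIrreducibleRep ρ)
    (hdist : invariantForms ρ (glBase k₀ k n : Set (GL (Fin n) k)) ≠ ⊥) :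
    invariantForms ρ.dual (glBase k₀ k n : Set (GL (Fin n) k)) ≠ ⊥ ∧
      RepIso (ρ.comp (glAut k₀ k σ n)) ρ.dual := by
  obtain ⟨φ, hφH, hφ⟩ := (Submodule.ne_bot_iff _).mp hdist
  have := hirr.finiteDimensional
  obtain ⟨v, hv, hvH⟩ := hirr.exists_fixed_vector hφ hφH
  exact ⟨invariantForms_dual_ne_bot hv hvH, hirr.repIso_comp_dual (glAut_glAut hquad)
    (exists_mem_glBase_mul_mul hquad hσ) hφ hφH hv hvH⟩
end
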